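/- For every n ≥ 1, the covariance of the numbers of occurrences of the patterns 123 and 312 in a uniformly random permutation of S_n satisfies (1/n!)·∑_{π ∈ S_n} (N_{123}(π) − binom(n,3)/6)(N_{312}(π) − binom(n,3)/6) = −n(n−1)(n−2)(39n² − 48n − 7)/43200. -/

import Mathlib

/-- The number of occurrences of the pattern `σ ∈ S_k` in the permutation `π ∈ S_n`. -/
def occ {k n : ℕ} (σ : Equiv.Perm (Fin k)) (π : Equiv.Perm (Fin n)) : ℕ :=
  (Finset.univ.filter (fun f : Fin k → Fin n =>
    (∀ a b : Fin k, a < b → f a < f b) ∧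
    (∀ a b : Fin k, π (f a) < π (f b) ↔ σ a < σ b))).card

/-- The pattern 123 (one-line notation), i.e. the identity of `S_3`. -/
def p123 : Equiv.Perm (Fin 3) := 1

/-- The pattern 132 (one-line notation). -/
def p132 : Equiv.Perm (Fin 3) := Equiv.swap 1 2

/-- The pattern 312 (one-line notation): 1 ↦ 3, 2 ↦ 1, 3 ↦ 2. -/
def p312 : Equiv.Perm (Fin 3) := ⟨![2, 0, 1], ![1, 2, 0], by decide, by decide⟩

/-- The pattern 321 (one-line notation). -/
def p321 : Equiv.Perm (Fin 3) := Equiv.swap 0 2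

open Finset

/-- The embeddings `f` of `Fin k` along which the word `u` has the pattern `σ`. -/
def occSet {k m n : ℕ} (σ : Equiv.Perm (Fin k)) (u : Fin m → Fin n) : Finset (Fin k → Fin m) :=
  univ.filter fun f => (∀ a b : Fin k, a < b → f a < f b) ∧
    ∀ a b : Fin k, u (f a) < u (f b) ↔ σ a < σ b

/-- The number of pairs of occurrences of `σ` and `τ` in `u` that jointly cover all positions. -/
def coverCount {k l m n : ℕ} (σ : Equiv.Perm (Fin k)) (τ : Equiv.Perm (Fin l))
    (u : Fin m → Fin n) : ℕ :=
  ((occSet σ u ×ˢ occSet τ u).filter fun p => univ.image p.1 ∪ univ.image p.2 = univ).card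

lemma comp_mem_occSet {k m n N : ℕ} (σ : Equiv.Perm (Fin k)) (u : Fin n → Fin N)
    (e : Fin m ↪o Fin n) (f : Fin k → Fin m) :
    e ∘ f ∈ occSet σ u ↔ f ∈ occSet σ (u ∘ e) := by
  simp [occSet]

lemma occSet_comp_strictMono {k m n N : ℕ} (σ : Equiv.Perm (Fin k)) (u : Fin m → Fin n)
    {v : Fin n → Fin N} (hv : StrictMono v) : occSet σ (v ∘ u) = occSet σ u := by
  simp [occSet, hv.lt_iff_lt]

lemma coverCount_comp_strictMono {k l m n N : ℕ} (σ : Equiv.Perm (Fin k))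
    (τ : Equiv.Perm (Fin l)) (u : Fin m → Fin n) {v : Fin n → Fin N} (hv : StrictMono v) :
    coverCount σ τ (v ∘ u) = coverCount σ τ u := by
  simp only [coverCount, occSet_comp_strictMono _ _ hv]

lemma coverCount_eq_zero {k l m n : ℕ} (σ : Equiv.Perm (Fin k)) (τ : Equiv.Perm (Fin l))
    (u : Fin m → Fin n) (h : k + l < m) : coverCount σ τ u = 0 := by
  rw [coverCount, card_eq_zero, filter_eq_empty_iff]
  rintro ⟨f, g⟩ - hfg
  have h1 := card_union_le (univ.image f) (univ.image g)
  have h2 : (univ.image f).card ≤ k := by simpa using card_image_le (s := univ) (f := f)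
  have h3 : (univ.image g).card ≤ l := by simpa using card_image_le (s := univ) (f := g)
  have h4 : (univ.image f ∪ univ.image g).card = m := by simpa using congrArg card hfg
  omega

lemma exists_comp_orderEmbOfFin {k n : ℕ} (S : Finset (Fin n)) (f : Fin k → Fin n)
    (h : univ.image f ⊆ S) : ∃ f' : Fin k → Fin S.card, S.orderEmbOfFin rfl ∘ f' = f := by
  have : ∀ a, ∃ b, S.orderEmbOfFin rfl b = f a := fun a => by
    have : f a ∈ Set.range (S.orderEmbOfFin rfl) := by
      rw [range_orderEmbOfFin]
      exact h (mem_image_of_mem f (mem_univ a))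
    exact this
  choose f' hf' using this
  exact ⟨f', funext hf'⟩

lemma occ_mul_occ {k l n : ℕ} (σ : Equiv.Perm (Fin k)) (τ : Equiv.Perm (Fin l))
    (π : Equiv.Perm (Fin n)) :
    occ σ π * occ τ π = ∑ S : Finset (Fin n), coverCount σ τ (π ∘ S.orderEmbOfFin rfl) := by
  have h : occ σ π * occ τ π = (occSet σ π ×ˢ occSet τ π).card := by
    rw [card_product]; rfl
  rw [h, card_eq_sum_card_fiberwise (f := fun p => univ.image p.1 ∪ univ.image p.2) (t := univ)
    (fun _ _ => mem_coe.2 (mem_univ _))]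
  refine sum_congr rfl fun S _ => ?_
  set e := S.orderEmbOfFin rfl with he
  have himage : ∀ (f : Fin k → Fin S.card) (g : Fin l → Fin S.card),
      univ.image (e ∘ f) ∪ univ.image (e ∘ g) = S ↔ univ.image f ∪ univ.image g = univ := by
    intro f g
    have hS : S = univ.image e := by rw [he, image_orderEmbOfFin_univ]
    rw [← image_image, ← image_image, ← image_union]
    conv_lhs => rhs; rw [hS]
    exact (image_injective e.injective).eq_iff
  symm
  refine card_bij (fun p _ => (e ∘ p.1, e ∘ p.2)) ?_ ?_ ?_
  · rintro ⟨f, g⟩ hp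
    simp only [mem_filter, mem_product] at hp ⊢
    exact ⟨⟨(comp_mem_occSet ..).2 hp.1.1, (comp_mem_occSet ..).2 hp.1.2⟩, (himage f g).2 hp.2⟩
  · rintro ⟨f, g⟩ - ⟨f', g'⟩ - h
    simp only [Prod.mk.injEq] at h ⊢
    exact ⟨e.injective.comp_left h.1, e.injective.comp_left h.2⟩
  · rintro ⟨f, g⟩ hp
    simp only [mem_filter, mem_product] at hp
    obtain ⟨f, rfl⟩ := exists_comp_orderEmbOfFin S f (hp.2 ▸ subset_union_left)
    obtain ⟨g, rfl⟩ := exists_comp_orderEmbOfFin S g (hp.2 ▸ subset_union_right)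
    refine ⟨(f, g), ?_, rfl⟩
    simp only [mem_filter, mem_product]
    exact ⟨⟨(comp_mem_occSet ..).1 hp.1.1, (comp_mem_occSet ..).1 hp.1.2⟩, (himage f g).1 hp.2⟩

lemma sum_coverCount_comp_perm {k l m n : ℕ} (σ : Equiv.Perm (Fin k)) (τ : Equiv.Perm (Fin l))
    (u : Fin m → Fin n) (hu : Function.Injective u) :
    ∑ s : Equiv.Perm (Fin m), coverCount σ τ (u ∘ s)
      = ∑ s : Equiv.Perm (Fin m), coverCount σ τ s := by
  have hv : StrictMono (u ∘ Tuple.sort u) :=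
    (Tuple.monotone_sort u).strictMono_of_injective (hu.comp (Tuple.sort u).injective)
  rw [← Equiv.sum_comp (Equiv.mulLeft (Tuple.sort u))
    (fun s : Equiv.Perm (Fin m) => coverCount σ τ (u ∘ s))]
  refine sum_congr rfl fun s _ => ?_
  have h : u ∘ Equiv.mulLeft (Tuple.sort u) s = (u ∘ Tuple.sort u) ∘ s := rfl
  rw [h, coverCount_comp_strictMono σ τ s hv]

lemma factorial_mul_sum_coverCount {k l m n : ℕ} (σ : Equiv.Perm (Fin k))
    (τ : Equiv.Perm (Fin l)) (e : Fin m ↪ Fin n) :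
    m.factorial * ∑ π : Equiv.Perm (Fin n), coverCount σ τ (π ∘ e)
      = n.factorial * ∑ s : Equiv.Perm (Fin m), coverCount σ τ s := by
  have h : ∀ s : Equiv.Perm (Fin m), ∑ π : Equiv.Perm (Fin n), coverCount σ τ ((π ∘ e) ∘ s)
      = ∑ π : Equiv.Perm (Fin n), coverCount σ τ (π ∘ e) := by
    intro s
    rw [← Equiv.sum_comp (Equiv.mulRight (s.viaFintypeEmbedding e))
      (fun π : Equiv.Perm (Fin n) => coverCount σ τ (π ∘ e))]
    refine sum_congr rfl fun π _ => congrArg _ (funext fun a => ?_)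
    simp
  calc _ = ∑ s : Equiv.Perm (Fin m), ∑ π : Equiv.Perm (Fin n), coverCount σ τ ((π ∘ e) ∘ s) := by
        simp [h, Fintype.card_perm]
    _ = ∑ π : Equiv.Perm (Fin n), ∑ s : Equiv.Perm (Fin m), coverCount σ τ ((π ∘ e) ∘ s) :=
        sum_comm
    _ = _ := by
        simp [fun π : Equiv.Perm (Fin n) =>
          sum_coverCount_comp_perm σ τ (π ∘ e) (π.injective.comp e.injective), Fintype.card_perm]

/-- The joint moment of two pattern counts is a fixed combination of `n.choose 0`, …,
`n.choose (k + l)`. -/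
lemma exists_sum_occ_mul_occ {k l : ℕ} (σ : Equiv.Perm (Fin k)) (τ : Equiv.Perm (Fin l)) :
    ∃ a : ℕ → ℚ, ∀ n : ℕ, ((∑ π : Equiv.Perm (Fin n), occ σ π * occ τ π : ℕ) : ℚ)
      = n.factorial * ∑ j ∈ range (k + l + 1), n.choose j * a j := by
  refine ⟨fun j => (∑ s : Equiv.Perm (Fin j), coverCount σ τ s : ℕ) / j.factorial, fun n => ?_⟩
  set a : ℕ → ℚ := fun j => (∑ s : Equiv.Perm (Fin j), coverCount σ τ s : ℕ) / j.factorial with ha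
  have hS : ∀ S : Finset (Fin n),
      ((∑ π : Equiv.Perm (Fin n), coverCount σ τ (π ∘ S.orderEmbOfFin rfl) : ℕ) : ℚ)
        = n.factorial * a S.card := by
    intro S
    have h := factorial_mul_sum_coverCount σ τ (S.orderEmbOfFin rfl).toEmbedding
    have h' := congrArg (Nat.cast : ℕ → ℚ) h
    rw [Nat.cast_mul, Nat.cast_mul] at h'
    rw [ha, mul_div_assoc', eq_div_iff (by positivity), mul_comm]
    exact h'
  have hzero : ∀ j, j ∉ range (k + l + 1) → a j = 0 := by
    intro j hj
    have : k + l < j := by simpa using hj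
    simp [ha, fun s : Equiv.Perm (Fin j) => coverCount_eq_zero σ τ s this]
  simp only [occ_mul_occ]
  rw [sum_comm, Nat.cast_sum, sum_congr rfl fun S _ => hS S, ← mul_sum, ← powerset_univ,
    sum_powerset_apply_card]
  simp only [card_univ, Fintype.card_fin, nsmul_eq_mul]
  congr 1
  calc _ = ∑ j ∈ range (n + 1) ∪ range (k + l + 1), (n.choose j : ℚ) * a j := by
        refine sum_subset subset_union_left fun j _ hj => ?_
        rw [Nat.choose_eq_zero_of_lt (by simpa using hj), Nat.cast_zero, zero_mul]
    _ = _ := by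
        refine (sum_subset subset_union_right fun j _ hj => ?_).symm
        rw [hzero j hj, mul_zero]

lemma cast_choose_succ (n j : ℕ) :
    (n.choose (j + 1) : ℚ) = n.choose j * ((n : ℚ) - j) / (j + 1) := by
  rw [eq_div_iff (by positivity)]
  rcases le_or_gt j n with h | h
  · have := congrArg (Nat.cast : ℕ → ℚ) (Nat.choose_succ_right_eq n j)
    push_cast [h] at this
    exact this
  · simp [Nat.choose_eq_zero_of_lt h, Nat.choose_eq_zero_of_lt (h.trans (Nat.lt_succ_self j))]

/-- The one-line notations of all permutations of `Fin n`. -/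
def permWords : ℕ → List (List ℕ)
  | 0 => [[]]
  | n + 1 => (List.finRange (n + 1)).flatMap fun p =>
      (permWords n).map fun l => p.val :: l.map fun x => if x + 1 = p.val then 0 else x + 1

/-- The number of pairs of positions `i < j` of a word whose entries satisfy `R`. -/
def countPairs (R : ℕ → ℕ → Bool) : List ℕ → ℕ
  | [] => 0
  | a :: l => l.countP (R a) + countPairs R l

/-- The number of triples of positions `i < j < k` of a word whose entries satisfy `R`. -/
def countTriples (R : ℕ → ℕ → ℕ → Bool) : List ℕ → ℕ
  | [] => 0
  | a :: l => countPairs (R a) l + countTriples R l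

lemma sum_perm_eq_sum_permWords (n : ℕ) (F : List ℕ → ℕ) :
    ∑ π : Equiv.Perm (Fin n), F (List.ofFn fun i => (π i).val) = ((permWords n).map F).sum := by
  induction n generalizing F with
  | zero => simp [permWords]
  | succ n ih =>
    rw [← Equiv.sum_comp Equiv.Perm.decomposeFin.symm, Fintype.sum_prod_type, permWords,
      List.map_flatMap, List.flatMap_def, List.sum_flatten, List.map_map, ← List.ofFn_eq_map, List.sum_ofFn]
    refine sum_congr rfl fun p _ => ?_
    rw [Function.comp_apply, List.map_map, ← ih]
    refine sum_congr rfl fun π _ => ?_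
    simp only [Function.comp, List.ofFn_succ, List.map_ofFn,
      Equiv.Perm.decomposeFin_symm_apply_zero, Equiv.Perm.decomposeFin_symm_apply_succ]
    congr 3
    funext i
    simp only [Equiv.swap_apply_def, Fin.ext_iff, Fin.val_succ, Fin.val_zero]
    split_ifs <;> simp_all

lemma countP_ofFn {n : ℕ} (R : ℕ → Bool) (u : Fin n → ℕ) :
    (List.ofFn u).countP R = ∑ i, if R (u i) then 1 else 0 := by
  induction n with
  | zero => simp
  | succ n ih => simp [List.ofFn_succ, List.countP_cons, ih, Fin.sum_univ_succ, add_comm, -sum_boole]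

lemma countPairs_ofFn {n : ℕ} (R : ℕ → ℕ → Bool) (u : Fin n → ℕ) :
    countPairs R (List.ofFn u) = ∑ i, ∑ j, if i < j ∧ R (u i) (u j) then 1 else 0 := by
  induction n with
  | zero => simp [countPairs]
  | succ n ih =>
    simp [List.ofFn_succ, countPairs, countP_ofFn, ih, Fin.sum_univ_succ, -sum_boole]

lemma countTriples_ofFn {n : ℕ} (R : ℕ → ℕ → ℕ → Bool) (u : Fin n → ℕ) :
    countTriples R (List.ofFn u)
      = ∑ i, ∑ j, ∑ k, if i < j ∧ j < k ∧ R (u i) (u j) (u k) then 1 else 0 := by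
  induction n with
  | zero => simp [countTriples]
  | succ n ih =>
    simp [List.ofFn_succ, countTriples, countPairs_ofFn, ih, Fin.sum_univ_succ, -sum_boole]

lemma occ_eq_countTriples {n : ℕ} (σ : Equiv.Perm (Fin 3)) (R : ℕ → ℕ → ℕ → Bool)
    (π : Equiv.Perm (Fin n))
    (hR : ∀ i j k : Fin n, R (π i) (π j) (π k) = true ↔
      ∀ a b : Fin 3, π (![i, j, k] a) < π (![i, j, k] b) ↔ σ a < σ b) :
    occ σ π = countTriples R (List.ofFn fun i => (π i).val) := by
  rw [countTriples_ofFn, occ, card_filter,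
    ← Equiv.sum_comp (Fin.consEquiv fun _ : Fin 3 => Fin n), Fintype.sum_prod_type]
  refine sum_congr rfl fun i _ => ?_
  rw [← Equiv.sum_comp (Fin.consEquiv fun _ : Fin 2 => Fin n), Fintype.sum_prod_type]
  refine sum_congr rfl fun j _ => ?_
  rw [← Equiv.sum_comp (Equiv.funUnique (Fin 1) (Fin n)).symm]
  refine sum_congr rfl fun k _ => ?_
  have hv : (Fin.consEquiv fun _ : Fin 3 => Fin n)
      (i, (Fin.consEquiv fun _ : Fin 2 => Fin n)
        (j, (Equiv.funUnique (Fin 1) (Fin n)).symm k)) = ![i, j, k] := by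
    ext a; fin_cases a <;> rfl
  rw [hv]
  refine if_congr ?_ rfl rfl
  rw [hR, ← and_assoc]
  refine and_congr_left fun _ => ?_
  simp [Fin.forall_fin_succ]
  exact fun h₁ h₂ => h₂.trans h₁

lemma occ_p123_eq {n : ℕ} (π : Equiv.Perm (Fin n)) :
    occ p123 π = countTriples (fun a b c => a.blt b && b.blt c)
      (List.ofFn fun i => (π i).val) := by
  refine occ_eq_countTriples _ _ _ fun i j k => ?_
  simp [Fin.forall_fin_succ, p123]
  omega

lemma occ_p312_eq {n : ℕ} (π : Equiv.Perm (Fin n)) :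
    occ p312 π = countTriples (fun a b c => b.blt c && c.blt a)
      (List.ofFn fun i => (π i).val) := by
  refine occ_eq_countTriples _ _ _ fun i j k => ?_
  simp [Fin.forall_fin_succ, p312]
  omega

lemma sum_occ_mul_occ_eq (n : ℕ) :
    ∑ π : Equiv.Perm (Fin n), occ p123 π * occ p312 π = ((permWords n).map fun l =>
      countTriples (fun a b c => a.blt b && b.blt c) l
        * countTriples (fun a b c => b.blt c && c.blt a) l).sum := by
  rw [← sum_perm_eq_sum_permWords]
  simp only [occ_p123_eq, occ_p312_eq]

lemma occ_fin_zero {n : ℕ} (σ : Equiv.Perm (Fin 0)) (π : Equiv.Perm (Fin n)) : occ σ π = 1 := by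
  simp [occ]

lemma occ_eq_zero_of_lt {k n : ℕ} (σ : Equiv.Perm (Fin k)) (π : Equiv.Perm (Fin n))
    (h : n < k) : occ σ π = 0 := by
  rw [occ, card_eq_zero, filter_eq_empty_iff]
  rintro f - ⟨hf, -⟩
  have := Fintype.card_le_of_injective f (StrictMono.injective fun a b => hf a b)
  simp at this
  omega

lemma sum_occ_three (n : ℕ) (σ : Equiv.Perm (Fin 3))
    (hσ : ∑ π : Equiv.Perm (Fin 3), occ σ π = 1) :
    ((∑ π : Equiv.Perm (Fin n), occ σ π : ℕ) : ℚ) = n.factorial * (n.choose 3 / 6) := by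
  obtain ⟨a, ha⟩ := exists_sum_occ_mul_occ σ (1 : Equiv.Perm (Fin 0))
  simp only [occ_fin_zero, mul_one] at ha
  have h0 := ha 0
  have h1 := ha 1
  have h2 := ha 2
  have h3 := ha 3
  rw [hσ] at h3
  norm_num [occ_eq_zero_of_lt, sum_range_succ, Nat.factorial, Nat.choose] at h0 h1 h2 h3
  have a0 : a 0 = 0 := by linarith
  have a1 : a 1 = 0 := by linarith
  have a2 : a 2 = 0 := by linarith
  have a3 : a 3 = 1 / 6 := by linarith
  rw [ha]
  simp only [sum_range_succ, range_zero, sum_empty, a0, a1, a2, a3]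
  ring

lemma sum_occ_p123_mul_occ_p312 (n : ℕ) :
    ((∑ π : Equiv.Perm (Fin n), occ p123 π * occ p312 π : ℕ) : ℚ) = n.factorial *
      (5 / 24 * n.choose 4 + 29 / 40 * n.choose 5 + 5 / 9 * n.choose 6) := by
  obtain ⟨a, ha⟩ := exists_sum_occ_mul_occ p123 p312
  have e3 : ∑ π : Equiv.Perm (Fin 3), occ p123 π * occ p312 π = 0 := by
    rw [sum_occ_mul_occ_eq]; decide +kernel
  have e4 : ∑ π : Equiv.Perm (Fin 4), occ p123 π * occ p312 π = 5 := by
    rw [sum_occ_mul_occ_eq]; decide +kernel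
  have e5 : ∑ π : Equiv.Perm (Fin 5), occ p123 π * occ p312 π = 212 := by
    rw [sum_occ_mul_occ_eq]; decide +kernel
  have e6 : ∑ π : Equiv.Perm (Fin 6), occ p123 π * occ p312 π = 5782 := by
    rw [sum_occ_mul_occ_eq]; decide +kernel
  have h0 := ha 0
  have h1 := ha 1
  have h2 := ha 2
  have h3 := ha 3
  have h4 := ha 4
  have h5 := ha 5
  have h6 := ha 6
  rw [e3] at h3
  rw [e4] at h4
  rw [e5] at h5
  rw [e6] at h6
  norm_num [occ_eq_zero_of_lt, sum_range_succ, Nat.factorial, Nat.choose]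
    at h0 h1 h2 h3 h4 h5 h6
  have a0 : a 0 = 0 := by linarith
  have a1 : a 1 = 0 := by linarith
  have a2 : a 2 = 0 := by linarith
  have a3 : a 3 = 0 := by linarith
  have a4 : a 4 = 5 / 24 := by linarith
  have a5 : a 5 = 29 / 40 := by linarith
  have a6 : a 6 = 5 / 9 := by linarith
  rw [ha]
  simp only [sum_range_succ, range_zero, sum_empty, a0, a1, a2, a3, a4, a5, a6]
  ring

theorem stmt6 (n : ℕ) (hn : 1 ≤ n) :
    (1 / (n.factorial : ℚ)) * ∑ π : Equiv.Perm (Fin n),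
        ((occ p123 π : ℚ) - (n.choose 3 : ℚ) / 6)
          * ((occ p312 π : ℚ) - (n.choose 3 : ℚ) / 6)
      = -((n : ℚ) * ((n : ℚ) - 1) * ((n : ℚ) - 2)
        * (39 * (n : ℚ) ^ 2 - 48 * (n : ℚ) - 7) / 43200) := by
  have h₁ := sum_occ_three n p123 (by decide +kernel)
  have h₂ := sum_occ_three n p312 (by decide +kernel)
  have h₁₂ := sum_occ_p123_mul_occ_p312 n
  push_cast at h₁ h₂ h₁₂
  have hfac : (n.factorial : ℚ) ≠ 0 := by positivity
  simp only [sub_mul, mul_sub, sum_sub_distrib, ← sum_mul, ← mul_sum, h₁, h₂, h₁₂, sum_const,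
    card_univ, Fintype.card_perm, Fintype.card_fin, nsmul_eq_mul]
  field_simp
  simp only [cast_choose_succ, Nat.choose_zero_right]
  push_cast
  ring
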